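/- arXiv:0909.3975 — 11 statements merged into one kernel-verified Lean document; each statement's English description precedes it below -/
import Mathlib

section
/- Let t_1, …, t_p and s_1, …, s_q be integers, all ≤ −2, and write [t_1; …; t_p] = a_1/b_1 and [s_1; …; s_q] = a_2/b_2 in lowest terms with a_1, a_2 > 0 and b_1, b_2 < 0. If a_1·a_2 + a_2·b_1 + a_1·b_2 = 1 (equivalently, 1 + b_1/a_1 + b_2/a_2 = 1/(a_1·a_2)), then 1/[t_1; …; t_{p−1}; t_p + 1] + 1/[s_1; …; s_q] ≤ −1 and 1/[t_1; …; t_p] + 1/[s_1; …; s_{q−1}; s_q + 1] ≤ −1 (for p = 1 the first modified fraction means [t_1 + 1], and for q = 1 the second means [s_1 + 1]). -/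
/-- Negative continued fraction `[m₁; m₂; …; m_p]`, defined by `[m_p] = m_p` and
`[m_i; …; m_p] = m_i - 1/[m_{i+1}; …; m_p]`.  (Junk value `0` on the empty list.) -/
def ncf : List ℤ → ℚ
  | [] => 0
  | [m] => (m : ℚ)
  | m :: l => (m : ℚ) - 1 / ncf l

/-- Add `1` to the last entry of a list of integers. -/
def addLastOne : List ℤ → List ℤ
  | [] => []
  | [m] => [m + 1]
  | m :: l => m :: addLastOne l

/-- Numerators and denominators of `ncf T`, of the truncation of `T` by one entry, and of
`ncf (addLastOne T)`, when all entries of `T` are at most `-2`. -/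
theorem exists_convergents_ncf (T : List ℤ) (hT : T ≠ []) (hT2 : ∀ x ∈ T, x ≤ -2) :
    ∃ A B A' B' : ℤ, 0 < B ∧ B < A ∧ 0 ≤ B' ∧ B' < A' ∧ 0 < B - B' ∧ B - B' ≤ A - A' ∧
      B * A' - A * B' = 1 ∧ ncf T = -(A / B : ℚ) ∧
      ncf (addLastOne T) = -((A - A') / (B - B') : ℚ) := by
  induction T with
  | nil => exact absurd rfl hT
  | cons m l ih =>
    have hm : m ≤ -2 := hT2 m (by simp)
    cases l with
    | nil =>
      refine ⟨-m, 1, 1, 0, by omega, by omega, by omega, by omega, by omega, by omega,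
        by ring, ?_, ?_⟩
      · simp [ncf]
      · simp [ncf, addLastOne]
        ring
    | cons n l =>
      obtain ⟨A, B, A', B', hB, hBA, hB', hBA', hD, hDA, hdet, hv, hv'⟩ :=
        ih (by simp) fun x hx => hT2 x (List.mem_cons_of_mem _ hx)
      have hne : addLastOne (n :: l) ≠ [] := by cases l <;> simp [addLastOne]
      have hcons : ∀ L : List ℤ, L ≠ [] → ncf (m :: L) = m - 1 / ncf L := by
        intro L hL
        cases L with
        | nil => exact absurd rfl hL
        | cons => simp [ncf]
      refine ⟨-m * A - B, A, -m * A' - B', A', by omega, by nlinarith, by omega, by nlinarith,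
        by omega, by nlinarith, by linear_combination hdet, ?_, ?_⟩
      · have hA0 : (A : ℚ) ≠ 0 := by exact_mod_cast (by omega : A ≠ 0)
        have hB0 : (B : ℚ) ≠ 0 := by exact_mod_cast (by omega : B ≠ 0)
        rw [hcons _ (by simp), hv]
        push_cast
        field_simp
        ring
      · have hA0 : (A - A' : ℚ) ≠ 0 := by exact_mod_cast (by omega : A - A' ≠ 0)
        have hB0 : (B - B' : ℚ) ≠ 0 := by exact_mod_cast (by omega : B - B' ≠ 0)
        rw [show addLastOne (m :: n :: l) = m :: addLastOne (n :: l) by simp [addLastOne],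
          hcons _ hne, hv']
        push_cast
        field_simp
        ring

theorem one_div_ncf_addLastOne_add_le (T : List ℤ) (hT : T ≠ []) (hT2 : ∀ x ∈ T, x ≤ -2)
    {a₁ b₁ a₂ b₂ : ℤ} (ha₁ : 0 < a₁) (hb₁ : b₁ < 0) (ha₂ : 0 < a₂)
    (hcop : Int.gcd a₁ b₁ = 1) (hval : (a₁ : ℚ) / (b₁ : ℚ) = ncf T)
    (heq : a₁ * a₂ + a₂ * b₁ + a₁ * b₂ = 1) :
    1 / ncf (addLastOne T) + (b₂ : ℚ) / a₂ ≤ -1 := by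
  obtain ⟨A, B, A', B', hB, hBA, hB', hBA', hD, hDA, hdet, hv, hv'⟩ :=
    exists_convergents_ncf T hT hT2
  have hcross : a₁ * B = A * -b₁ := by
    have hB0 : (B : ℚ) ≠ 0 := by exact_mod_cast hB.ne'
    have hb0 : (b₁ : ℚ) ≠ 0 := by exact_mod_cast hb₁.ne
    rw [hv] at hval
    field_simp at hval
    have : a₁ * B = -(b₁ * A) := by exact_mod_cast hval
    linarith
  have hAB : IsCoprime A B := ⟨-B', A', by linear_combination hdet⟩
  have hab : IsCoprime a₁ (-b₁) := (Int.isCoprime_iff_gcd_eq_one.mpr hcop).neg_right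
  obtain rfl : A = a₁ :=
    Int.dvd_antisymm (by omega) ha₁.le
      (hAB.dvd_of_dvd_mul_right ⟨-b₁, hcross⟩) (hab.dvd_of_dvd_mul_right ⟨B, hcross.symm⟩)
  obtain rfl : B = -b₁ := mul_left_cancel₀ ha₁.ne' hcross
  have hle : A - A' ≤ a₂ := by
    have hdvd : A ∣ A - A' - a₂ :=
      hab.dvd_of_dvd_mul_left
        ⟨-b₁ - B' - a₂ - b₂, by linear_combination heq - hdet⟩
    by_contra! hlt
    have := Int.le_of_dvd (by omega) hdvd
    omega
  have hkey : (A - A') * a₂ ≤ (-b₁ - B') * a₂ - b₂ * (A - A') := by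
    refine le_of_mul_le_mul_left ?_ ha₁
    linear_combination hle - a₂ * hdet + (A - A') * heq
  have hD0 : (0 : ℚ) < A - A' := by exact_mod_cast (by omega : 0 < A - A')
  have ha0 : (0 : ℚ) < a₂ := by exact_mod_cast ha₂
  have hkeyQ : ((A : ℚ) - A') * a₂ ≤ (-b₁ - B') * a₂ - b₂ * (A - A') := by exact_mod_cast hkey
  rw [hv', one_div, inv_neg, inv_div, neg_add_eq_sub, div_sub_div _ _ ha0.ne' hD0.ne',
    div_le_iff₀ (mul_pos ha0 hD0)]
  push_cast
  linarith

/-- if `[t₁;…;t_p] = a₁/b₁` and `[s₁;…;s_q] = a₂/b₂` in lowest terms, with all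
entries `≤ -2`, `a₁, a₂ > 0`, `b₁, b₂ < 0`, and `a₁a₂ + a₂b₁ + a₁b₂ = 1`, then
`1/[t₁;…;t_{p-1};t_p+1] + 1/[s₁;…;s_q] ≤ -1` and `1/[t₁;…;t_p] + 1/[s₁;…;s_{q-1};s_q+1] ≤ -1`. -/
theorem stmt_0 (T S : List ℤ) (hT : T ≠ []) (hS : S ≠ [])
    (hT2 : ∀ x ∈ T, x ≤ -2) (hS2 : ∀ x ∈ S, x ≤ -2)
    (a₁ b₁ a₂ b₂ : ℤ)
    (ha₁ : 0 < a₁) (hb₁ : b₁ < 0) (ha₂ : 0 < a₂) (hb₂ : b₂ < 0)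
    (hcop₁ : Int.gcd a₁ b₁ = 1) (hcop₂ : Int.gcd a₂ b₂ = 1)
    (hval₁ : (a₁ : ℚ) / (b₁ : ℚ) = ncf T)
    (hval₂ : (a₂ : ℚ) / (b₂ : ℚ) = ncf S)
    (heq : a₁ * a₂ + a₂ * b₁ + a₁ * b₂ = 1) :
    1 / ncf (addLastOne T) + 1 / ncf S ≤ -1 ∧
      1 / ncf T + 1 / ncf (addLastOne S) ≤ -1 := by
  constructor
  · rw [← hval₂, one_div_div]
    exact one_div_ncf_addLastOne_add_le T hT hT2 ha₁ hb₁ ha₂ hcop₁ hval₁ heq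
  · rw [← hval₁, one_div_div, add_comm]
    exact one_div_ncf_addLastOne_add_le S hS hS2 ha₂ hb₂ ha₁ hcop₂ hval₂
      (by linear_combination heq)
end

section
/- The only triple (p_1, p_2, p_3) of positive integers with p_1 ≤ p_2 ≤ p_3 satisfying 2 − (p_1/(p_1+1) + p_2/(p_2+1) + p_3/(p_3+1)) = 1/((p_1+1)(p_2+1)(p_3+1)) is (p_1, p_2, p_3) = (1, 2, 4). -/
/-- the only triple `(p₁, p₂, p₃)` of positive integers with `p₁ ≤ p₂ ≤ p₃` and
`2 - (p₁/(p₁+1) + p₂/(p₂+1) + p₃/(p₃+1)) = 1/((p₁+1)(p₂+1)(p₃+1))` is `(1, 2, 4)`. -/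
theorem stmt_2 (p₁ p₂ p₃ : ℤ) (h₁ : 0 < p₁) (h₁₂ : p₁ ≤ p₂) (h₂₃ : p₂ ≤ p₃)
    (heq : (2 : ℚ) - ((p₁ : ℚ) / ((p₁ : ℚ) + 1) + (p₂ : ℚ) / ((p₂ : ℚ) + 1)
        + (p₃ : ℚ) / ((p₃ : ℚ) + 1))
      = 1 / (((p₁ : ℚ) + 1) * ((p₂ : ℚ) + 1) * ((p₃ : ℚ) + 1))) :
    p₁ = 1 ∧ p₂ = 2 ∧ p₃ = 4 := by
  have h₂ : 0 < p₂ := h₁.trans_le h₁₂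
  have h₃ : 0 < p₃ := h₂.trans_le h₂₃
  have q₁ : (p₁ : ℚ) + 1 ≠ 0 := by exact_mod_cast (by omega : p₁ + 1 ≠ 0)
  have q₂ : (p₂ : ℚ) + 1 ≠ 0 := by exact_mod_cast (by omega : p₂ + 1 ≠ 0)
  have q₃ : (p₃ : ℚ) + 1 ≠ 0 := by exact_mod_cast (by omega : p₃ + 1 ≠ 0)
  have key : p₁ * p₂ * p₃ = p₁ + p₂ + p₃ + 1 := by
    field_simp at heq
    have : (p₁ : ℚ) * p₂ * p₃ = p₁ + p₂ + p₃ + 1 := by linarith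
    exact_mod_cast this
  have hp₁ : p₁ = 1 := by
    by_contra hne
    have h2 : 2 ≤ p₁ := by omega
    have h4 : 4 ≤ p₁ * p₂ := by nlinarith
    nlinarith
  subst hp₁
  have hp₂ : p₂ < 3 := by
    by_contra! hge
    nlinarith
  interval_cases p₂ <;> omega
end

section
/- If n ≥ 1 and p_1, …, p_n are positive integers satisfying 2 − (p_1/(p_1+1) + p_2/(p_2+1) + … + p_n/(p_n+1)) = 1/((p_1+1)(p_2+1)⋯(p_n+1)), then n = 3. -/
/-- if `p₁, …, p_n` are positive integers (`n ≥ 1`) with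
`2 - Σᵢ pᵢ/(pᵢ+1) = 1/Πᵢ (pᵢ+1)`, then `n = 3`. -/
theorem stmt_3 (n : ℕ) (hn : 1 ≤ n) (p : Fin n → ℤ) (hp : ∀ i, 0 < p i)
    (heq : (2 : ℚ) - ∑ i, (p i : ℚ) / ((p i : ℚ) + 1)
      = 1 / ∏ i, ((p i : ℚ) + 1)) :
    n = 3 := by
  have hp' : ∀ i, (1 : ℚ) ≤ p i := fun i => by exact_mod_cast hp i
  have hprod : (0 : ℚ) < 1 / ∏ i, ((p i : ℚ) + 1) :=
    one_div_pos.mpr (Finset.prod_pos fun i _ => by linarith [hp' i])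
  have hsum : (n : ℚ) * (1 / 2) ≤ ∑ i, (p i : ℚ) / ((p i : ℚ) + 1) := by
    have h := Finset.card_nsmul_le_sum Finset.univ (fun i => (p i : ℚ) / ((p i : ℚ) + 1)) (1 / 2)
      fun i _ => by
        rw [div_le_div_iff₀ two_pos (by linarith [hp' i])]
        linarith [hp' i]
    simpa using h
  have hlt : n < 4 := by
    have : (n : ℚ) < 4 := by linarith
    exact_mod_cast this
  interval_cases n
  · have h0 := hp' 0
    simp only [Fin.sum_univ_one, Fin.prod_univ_one] at heq
    field_simp at heq
    linarith
  · have h0 := hp' 0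
    have h1 := hp' 1
    simp only [Fin.sum_univ_two, Fin.prod_univ_two] at heq
    field_simp at heq
    linarith
  · rfl
end

section
/- For every n ≥ 1 there are no positive integers p_1, …, p_n satisfying 1 − (p_1/(2p_1+1) + p_2/(2p_2+1) + … + p_n/(2p_n+1)) = 1/((2p_1+1)(2p_2+1)⋯(2p_n+1)). -/
/-- for every `n ≥ 1` there are no positive integers `p₁, …, p_n` with
`1 - Σᵢ pᵢ/(2pᵢ+1) = 1/Πᵢ (2pᵢ+1)`. -/
theorem stmt_4 (n : ℕ) (hn : 1 ≤ n) (p : Fin n → ℤ) (hp : ∀ i, 0 < p i) :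
    (1 : ℚ) - ∑ i, (p i : ℚ) / (2 * (p i : ℚ) + 1)
      ≠ 1 / ∏ i, (2 * (p i : ℚ) + 1) := by
  intro h
  have hp1 : ∀ i, (1 : ℚ) ≤ p i := fun i => by exact_mod_cast hp i
  obtain hn3 | hn3 := le_or_gt 3 n
  · -- each summand is at least `1/3`, so the left side is nonpositive
    have hsum : ∑ _i : Fin n, (1 / 3 : ℚ) ≤ ∑ i, (p i : ℚ) / (2 * (p i : ℚ) + 1) := by
      refine Finset.sum_le_sum fun i _ => ?_
      have := hp1 i
      rw [div_le_div_iff₀ (by norm_num) (by linarith)]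
      linarith
    have hprod : (0 : ℚ) < 1 / ∏ i, (2 * (p i : ℚ) + 1) :=
      one_div_pos.mpr (Finset.prod_pos fun i _ => by linarith [hp1 i])
    have hcast : (3 : ℚ) ≤ n := by exact_mod_cast hn3
    simp only [Finset.sum_const, Finset.card_univ, Fintype.card_fin, nsmul_eq_mul] at hsum
    linarith
  · interval_cases n
    · have h0 := hp1 0
      have hx : 2 * (p 0 : ℚ) + 1 ≠ 0 := by linarith
      simp only [Fin.sum_univ_one, Fin.prod_univ_one] at h
      field_simp at h
      linarith
    · have h0 := hp1 0
      have h1 := hp1 1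
      have hx : 2 * (p 0 : ℚ) + 1 ≠ 0 := by linarith
      have hy : 2 * (p 1 : ℚ) + 1 ≠ 0 := by linarith
      simp only [Fin.sum_univ_two, Fin.prod_univ_two] at h
      field_simp at h
      linarith
end

section
/- Let a_1, a_2, b_1, b_2 be integers with a_1, a_2 > 0 and b_1, b_2 < 0 satisfying a_1·a_2 + a_2·b_1 + a_1·b_2 = 1. Then exactly one of the two rational numbers b_1/a_1, b_2/a_2 is ≤ −1/2 and the other is > −1/2 (equivalently, exactly one of a_1/b_1, a_2/b_2 is ≥ −2). -/
theorem div_le_neg_half_iff {a b : ℤ} (ha : 0 < a) :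
    (b : ℚ) / (a : ℚ) ≤ -1/2 ↔ a + 2 * b ≤ 0 := by
  rw [div_le_iff₀ (by exact_mod_cast ha : (0 : ℚ) < a), ← Int.cast_le (R := ℚ)]
  push_cast
  constructor <;> intro h <;> linarith

/-- if `a₁, a₂ > 0`, `b₁, b₂ < 0` and `a₁a₂ + a₂b₁ + a₁b₂ = 1`, then exactly one
of `b₁/a₁`, `b₂/a₂` is `≤ -1/2` and the other is `> -1/2`. -/
theorem stmt_5 (a₁ a₂ b₁ b₂ : ℤ) (ha₁ : 0 < a₁) (ha₂ : 0 < a₂)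
    (hb₁ : b₁ < 0) (hb₂ : b₂ < 0)
    (heq : a₁ * a₂ + a₂ * b₁ + a₁ * b₂ = 1) :
    ((b₁ : ℚ) / (a₁ : ℚ) ≤ -1/2 ∧ -1/2 < (b₂ : ℚ) / (a₂ : ℚ)) ∨
      ((b₂ : ℚ) / (a₂ : ℚ) ≤ -1/2 ∧ -1/2 < (b₁ : ℚ) / (a₁ : ℚ)) := by
  simp only [← not_le, div_le_neg_half_iff ha₁, div_le_neg_half_iff ha₂]
  have hsum : a₂ * (a₁ + 2 * b₁) + a₁ * (a₂ + 2 * b₂) = 2 := by linear_combination 2 * heq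
  rcases le_or_gt (a₁ + 2 * b₁) 0 with hx | hx <;> rcases le_or_gt (a₂ + 2 * b₂) 0 with hy | hy
  · nlinarith
  · exact Or.inl ⟨hx, hy.not_ge⟩
  · exact Or.inr ⟨hy, hx.not_ge⟩
  · have h₁ : a₂ ≤ a₂ * (a₁ + 2 * b₁) := le_mul_of_one_le_right ha₂.le hx
    have h₂ : a₁ ≤ a₁ * (a₂ + 2 * b₂) := le_mul_of_one_le_right ha₁.le hy
    omega
end

section
/- Let a_1, a_2, b_1, b_2 be integers with a_1, a_2 > 0 and b_1, b_2 < 0 satisfying a_1·a_2 + a_2·b_1 + a_1·b_2 = 1, and suppose a_1 < −2·b_1 (i.e., a_1/b_1 > −2). Then, setting a_1' = −b_1, b_1' = 2·b_1 + a_1, a_2' = a_2 + b_2, b_2' = b_2, one has: a_1'·a_2' + a_2'·b_1' + a_1'·b_2' = 1, a_1' > 0, a_2' > 0, b_1' < 0, b_2' < 0, and moreover a_1' < a_1 and a_2' < a_2. -/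
/-- if `a₁, a₂ > 0 > b₁, b₂`, `a₁a₂ + a₂b₁ + a₁b₂ = 1` and `a₁ < -2b₁`,
then the quadruple `(a₁', b₁', a₂', b₂') = (-b₁, 2b₁ + a₁, a₂ + b₂, b₂)` again satisfies the
equation, has the same sign pattern, and is simpler: `a₁' < a₁` and `a₂' < a₂`. -/
theorem stmt_6 (a₁ a₂ b₁ b₂ : ℤ) (ha₁ : 0 < a₁) (ha₂ : 0 < a₂)
    (hb₁ : b₁ < 0) (hb₂ : b₂ < 0)
    (heq : a₁ * a₂ + a₂ * b₁ + a₁ * b₂ = 1) (hlt : a₁ < -2 * b₁) :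
    (-b₁) * (a₂ + b₂) + (a₂ + b₂) * (2 * b₁ + a₁) + (-b₁) * b₂ = 1 ∧
      0 < -b₁ ∧ 0 < a₂ + b₂ ∧ 2 * b₁ + a₁ < 0 ∧ b₂ < 0 ∧
      -b₁ < a₁ ∧ a₂ + b₂ < a₂ := by
  have h₁ : 0 < a₁ + b₁ := by
    refine pos_of_mul_pos_right (a := a₂) ?_ ha₂.le
    linarith [mul_neg_of_pos_of_neg ha₁ hb₂]
  have h₂ : 0 < a₂ + b₂ := by
    refine pos_of_mul_pos_right (a := a₁) ?_ ha₁.le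
    linarith [mul_neg_of_pos_of_neg ha₂ hb₁]
  refine ⟨by linear_combination heq, ?_, h₂, ?_, hb₂, ?_, ?_⟩ <;> linarith
end

section
/- Let t_1, …, t_p and s_1, …, s_q be integers. Define integer sequences A_1, …, A_{p+1}, B_1, …, B_{p+1} backwards by A_{p+1} = 1, B_{p+1} = 0, B_ℓ = −A_{ℓ+1}, A_ℓ = −t_ℓ·A_{ℓ+1} + B_{ℓ+1}, and similarly C_1, …, C_{q+1}, D_1, …, D_{q+1} from s_1, …, s_q. Then C_1·Σ_{i=1}^{p} B_i·(−2 − t_i) + A_1·Σ_{j=1}^{q} D_j·(−2 − s_j) + A_1·C_1 = A_1 + C_1 − (A_1·C_1 + C_1·B_1 + A_1·D_1). In particular, if A_1·C_1 + C_1·B_1 + A_1·D_1 = 1, the left-hand side equals A_1 + C_1 − 1. -/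
/-- Each summand is the difference of consecutive values of `A + B`, so the sum telescopes. -/
theorem sum_mul_neg_two_sub_eq (p : ℕ) (t A B : ℕ → ℤ)
    (hrec : ∀ ℓ, 1 ≤ ℓ → ℓ ≤ p →
      B ℓ = -A (ℓ + 1) ∧ A ℓ = -t ℓ * A (ℓ + 1) + B (ℓ + 1)) :
    ∑ i ∈ Finset.Icc 1 p, B i * (-2 - t i) = A (p + 1) + B (p + 1) - (A 1 + B 1) := by
  induction p with
  | zero => simp
  | succ n ih =>
    rw [Finset.sum_Icc_succ_top (by lia), ih fun ℓ h₁ h₂ => hrec ℓ h₁ (by lia)]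
    obtain ⟨hB, hA⟩ := hrec (n + 1) (by lia) le_rfl
    linear_combination hA + (-1 - t (n + 1)) * hB


/-- with `A, B` defined backwards from `t₁, …, t_p` by `A_{p+1} = 1`,
`B_{p+1} = 0`, `B_ℓ = -A_{ℓ+1}`, `A_ℓ = -t_ℓ A_{ℓ+1} + B_{ℓ+1}`, and `C, D` similarly from
`s₁, …, s_q`, one has
`C₁·Σᵢ Bᵢ(-2 - tᵢ) + A₁·Σⱼ Dⱼ(-2 - sⱼ) + A₁C₁ = A₁ + C₁ - (A₁C₁ + C₁B₁ + A₁D₁)`;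
in particular, if `A₁C₁ + C₁B₁ + A₁D₁ = 1`, the left-hand side equals `A₁ + C₁ - 1`. -/
theorem stmt_11 (p q : ℕ) (hp : 1 ≤ p) (hq : 1 ≤ q) (t s : ℕ → ℤ)
    (A B : ℕ → ℤ) (hA : A (p + 1) = 1) (hB : B (p + 1) = 0)
    (hrecAB : ∀ ℓ, 1 ≤ ℓ → ℓ ≤ p →
      B ℓ = -A (ℓ + 1) ∧ A ℓ = -t ℓ * A (ℓ + 1) + B (ℓ + 1))
    (C D : ℕ → ℤ) (hC : C (q + 1) = 1) (hD : D (q + 1) = 0)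
    (hrecCD : ∀ ℓ, 1 ≤ ℓ → ℓ ≤ q →
      D ℓ = -C (ℓ + 1) ∧ C ℓ = -s ℓ * C (ℓ + 1) + D (ℓ + 1)) :
    (C 1 * (∑ i ∈ Finset.Icc 1 p, B i * (-2 - t i))
        + A 1 * (∑ j ∈ Finset.Icc 1 q, D j * (-2 - s j)) + A 1 * C 1
      = A 1 + C 1 - (A 1 * C 1 + C 1 * B 1 + A 1 * D 1)) ∧
    (A 1 * C 1 + C 1 * B 1 + A 1 * D 1 = 1 →
      C 1 * (∑ i ∈ Finset.Icc 1 p, B i * (-2 - t i))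
          + A 1 * (∑ j ∈ Finset.Icc 1 q, D j * (-2 - s j)) + A 1 * C 1
        = A 1 + C 1 - 1) := by
  have key : C 1 * (∑ i ∈ Finset.Icc 1 p, B i * (-2 - t i))
        + A 1 * (∑ j ∈ Finset.Icc 1 q, D j * (-2 - s j)) + A 1 * C 1
      = A 1 + C 1 - (A 1 * C 1 + C 1 * B 1 + A 1 * D 1) := by
    rw [sum_mul_neg_two_sub_eq p t A B hrecAB, sum_mul_neg_two_sub_eq q s C D hrecCD,
      hA, hB, hC, hD]
    ring
  exact ⟨key, fun h => by rw [key, h]⟩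
end

section
/- Let G be a finite weighted graph with weight function m : V(G) → ℤ. If n_0, n_1, …, n_N is a good sequence for G, then −n_N, −n_{N−1}, …, −n_0 is also a good sequence for G. -/
def IsAssociation {V : Type*} (m n : V → ℤ) : Prop :=
  ∀ v, n v ≡ m v [ZMOD 2] ∧ |n v| ≤ -m v

def IsInitial {V : Type*} (m n : V → ℤ) : Prop :=
  ∀ v, m v < n v ∧ n v ≤ -m v

def IsFinal {V : Type*} (m n : V → ℤ) : Prop :=
  ∀ v, m v ≤ n v ∧ n v < -m v

/-- The association `n` may be changed to `n'` at the vertex `v`. -/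
def ChangeAt {V : Type*} (G : SimpleGraph V) (m : V → ℤ) (n n' : V → ℤ) (v : V) : Prop :=
  n v = -m v ∧ n' v = m v ∧ (∀ w, G.Adj v w → n' w = n w + 2) ∧
    (∀ w, w ≠ v → ¬ G.Adj v w → n' w = n w)

/-- `n 0, n 1, …, n N` is a good sequence for the weighted graph `(G, m)`. -/
def IsGoodSequence {V : Type*} (G : SimpleGraph V) (m : V → ℤ) (N : ℕ)
    (n : ℕ → V → ℤ) : Prop :=
  (∀ i ≤ N, IsAssociation m (n i)) ∧ IsInitial m (n 0) ∧ IsFinal m (n N) ∧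
    ∀ i, 1 ≤ i → i ≤ N → ∃ v, ChangeAt G m (n (i - 1)) (n i) v

theorem IsAssociation.neg {V : Type*} {m n : V → ℤ} (h : IsAssociation m n) :
    IsAssociation m (fun x => -(n x)) := by
  intro v
  obtain ⟨hmod, habs⟩ := h v
  refine ⟨?_, by rwa [abs_neg]⟩
  simp only [Int.ModEq] at hmod ⊢
  omega

theorem IsFinal.neg {V : Type*} {m n : V → ℤ} (h : IsFinal m n) :
    IsInitial m (fun x => -(n x)) :=
  fun v => ⟨lt_neg_of_lt_neg (h v).2, neg_le_neg (h v).1⟩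

theorem IsInitial.neg {V : Type*} {m n : V → ℤ} (h : IsInitial m n) :
    IsFinal m (fun x => -(n x)) :=
  fun v => ⟨le_neg_of_le_neg (h v).2, neg_lt_neg (h v).1⟩

theorem ChangeAt.neg {V : Type*} {G : SimpleGraph V} {m n n' : V → ℤ} {v : V}
    (h : ChangeAt G m n n' v) :
    ChangeAt G m (fun x => -(n' x)) (fun x => -(n x)) v := by
  obtain ⟨hv, hv', hadj, hother⟩ := h
  refine ⟨by simp [hv'], by simp [hv], fun w hw => ?_, fun w hne hw => ?_⟩
  · simp [hadj w hw]
  · simp [hother w hne hw]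

/-- if `n₀, …, n_N` is a good sequence for the finite weighted graph `(G, m)`,
then so is the reversed negated sequence `-n_N, -n_{N-1}, …, -n₀`. -/
theorem stmt_13 {V : Type*} [Fintype V] (G : SimpleGraph V) (m : V → ℤ)
    (N : ℕ) (n : ℕ → V → ℤ) (h : IsGoodSequence G m N n) :
    IsGoodSequence G m N (fun i x => -(n (N - i) x)) := by
  obtain ⟨hassoc, hinit, hfinal, hchange⟩ := h
  refine ⟨fun i _ => (hassoc (N - i) (Nat.sub_le N i)).neg, ?_, ?_, fun i h1 hN => ?_⟩
  · simpa using hfinal.neg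
  · simpa using hinit.neg
  · obtain ⟨v, hv⟩ := hchange (N - (i - 1)) (by omega) (by omega)
    rw [show N - (i - 1) - 1 = N - i by omega] at hv
    exact ⟨v, hv.neg⟩
end

section
/- Let G be a finite weighted graph with weight function m : V(G) → ℤ, let n_0, n_1, …, n_N be a good sequence for G, and let n be an initial association with n(w) ≤ n_0(w) for every vertex w. Then there exists a good sequence n = n'_0, n'_1, …, n'_M for G starting at n, with M ≤ N. -/
namespace WeightedGraph

open Matrix

variable {V : Type*}

open Classical in
/-- The intersection form of the weighted graph `(G, m)`. -/
noncomputable def intersectionForm (G : SimpleGraph V) (m : V → ℤ) : Matrix V V ℤ :=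
  G.adjMatrix ℤ + Matrix.diagonal m

variable {G : SimpleGraph V} {m : V → ℤ}

lemma intersectionForm_apply_self (v : V) : intersectionForm G m v v = m v := by
  simp [intersectionForm]

lemma intersectionForm_apply_adj {v w : V} (h : G.Adj v w) : intersectionForm G m w v = 1 := by
  simp [intersectionForm, h.symm, h.ne']

lemma intersectionForm_apply_not_adj {v w : V} (hne : w ≠ v) (h : ¬ G.Adj v w) :
    intersectionForm G m w v = 0 := by
  simp [intersectionForm, hne, mt G.adj_symm h]

lemma intersectionForm_nonneg {v w : V} (hne : w ≠ v) : 0 ≤ intersectionForm G m w v := by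
  by_cases h : G.Adj v w
  · simp [intersectionForm_apply_adj h]
  · simp [intersectionForm_apply_not_adj hne h]

lemma intersectionForm_transpose : (intersectionForm G m)ᵀ = intersectionForm G m := by
  simp [intersectionForm]

lemma eq_of_changeAt {p q q' : V → ℤ} {v : V} (h : ChangeAt G m p q v)
    (h' : ChangeAt G m p q' v) : q = q' := by
  obtain ⟨-, h₁, h₂, h₃⟩ := h
  obtain ⟨-, h₁', h₂', h₃'⟩ := h'
  funext w
  by_cases hw : w = v
  · rw [hw, h₁, h₁']
  by_cases ha : G.Adj v w
  · rw [h₂ w ha, h₂' w ha]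
  · rw [h₃ w hw ha, h₃' w hw ha]

lemma add_single_le [DecidableEq V] {c d : V → ℤ} {v : V} (h : c ≤ d) (hv : c v < d v) :
    c + Pi.single v 1 ≤ d := fun w => by
  obtain rfl | hw := eq_or_ne w v
  · simpa using hv
  · simpa [hw] using h w

lemma counts_mono [DecidableEq V] {N : ℕ} {c : ℕ → V → ℤ}
    (hc : ∀ i < N, ∃ v, c (i + 1) = c i + Pi.single v 1) {i : ℕ} (hi : i ≤ N) :
    c i ≤ c N := by
  induction hi using Nat.decreasingInduction with
  | self => exact le_rfl
  | of_succ i hi ih =>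
    obtain ⟨v, hv⟩ := hc i hi
    refine le_trans ?_ ih
    rw [hv]
    exact le_add_of_nonneg_right (Pi.single_nonneg.2 zero_le_one)

variable [Fintype V]

/-- The association obtained from `n` after changing `c v` times at each vertex `v`. -/
noncomputable def changed (G : SimpleGraph V) (m n c : V → ℤ) : V → ℤ :=
  n + 2 • intersectionForm G m *ᵥ c

/-- The quadratic function whose increment under a change at `v` is `n v + m v`. -/
noncomputable def energy (G : SimpleGraph V) (m n c : V → ℤ) : ℤ :=
  n ⬝ᵥ c + c ⬝ᵥ intersectionForm G m *ᵥ c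

@[simp] lemma changed_zero (n : V → ℤ) : changed G m n 0 = n := by
  simp [changed]

@[simp] lemma energy_zero (n : V → ℤ) : energy G m n 0 = 0 := by
  simp [energy]

lemma changed_modEq (n c : V → ℤ) (v : V) : changed G m n c v ≡ n v [ZMOD 2] := by
  simp [changed, Int.modEq_iff_dvd]

lemma changed_mono_left {n n' : V → ℤ} (h : n ≤ n') (c : V → ℤ) :
    changed G m n c ≤ changed G m n' c :=
  add_le_add_left h _

lemma energy_mono_left {n n' : V → ℤ} (h : n ≤ n') {c : V → ℤ} (hc : 0 ≤ c) :
    energy G m n c ≤ energy G m n' c :=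
  add_le_add_left (dotProduct_le_dotProduct_of_nonneg_right h hc) _

lemma changed_le_of_apply_eq (n : V → ℤ) {c d : V → ℤ} {v : V} (h : c ≤ d) (hv : c v = d v) :
    changed G m n c v ≤ changed G m n d v := by
  have : (intersectionForm G m *ᵥ c) v ≤ (intersectionForm G m *ᵥ d) v := by
    refine Finset.sum_le_sum fun u _ => ?_
    obtain rfl | hu := eq_or_ne v u
    · rw [hv]
    · exact mul_le_mul_of_nonneg_left (h u) (intersectionForm_nonneg hu)
  simpa [changed, smul_mulVec] using this

variable [DecidableEq V]

lemma changed_add_single (n c : V → ℤ) (v w : V) :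
    changed G m n (c + Pi.single v 1) w = changed G m n c w + 2 * intersectionForm G m w v := by
  simp [changed, mulVec_add]
  ring

lemma energy_add_single (n c : V → ℤ) (v : V) :
    energy G m n (c + Pi.single v 1) = energy G m n c + (changed G m n c v + m v) := by
  have h : c ⬝ᵥ (intersectionForm G m).col v = (intersectionForm G m *ᵥ c) v := by
    conv_rhs => rw [← intersectionForm_transpose]
    rw [dotProduct_comm]
    rfl
  simp [energy, changed, mulVec_add, h, intersectionForm_apply_self]
  ring

lemma changeAt_changed {n c : V → ℤ} {v : V} (h : changed G m n c v = -m v) :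
    ChangeAt G m (changed G m n c) (changed G m n (c + Pi.single v 1)) v := by
  refine ⟨h, ?_, fun w hw => ?_, fun w hne hw => ?_⟩
  · rw [changed_add_single, h, intersectionForm_apply_self]
    ring
  · rw [changed_add_single, intersectionForm_apply_adj hw, mul_one]
  · rw [changed_add_single, intersectionForm_apply_not_adj hne hw, mul_zero, add_zero]

/-- The numbers of changes made at each vertex along a sequence of changes. -/
lemma exists_counts {N : ℕ} {s : ℕ → V → ℤ}
    (h : ∀ i < N, ∃ v, ChangeAt G m (s i) (s (i + 1)) v) :
    ∃ c : ℕ → V → ℤ, c 0 = 0 ∧ (∀ i ≤ N, changed G m (s 0) (c i) = s i) ∧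
      ∀ i < N, ∃ v, s i v = -m v ∧ c (i + 1) = c i + Pi.single v 1 := by
  have he : ∀ i, ∃ e : V → ℤ, i < N →
      ∃ v, ChangeAt G m (s i) (s (i + 1)) v ∧ e = Pi.single v 1 := fun i => by
    by_cases hi : i < N
    · obtain ⟨v, hv⟩ := h i hi
      exact ⟨Pi.single v 1, fun _ => ⟨v, hv, rfl⟩⟩
    · exact ⟨0, fun hi' => absurd hi' hi⟩
  choose e he using he
  refine ⟨fun i => ∑ j ∈ Finset.range i, e j, by simp, fun i => ?_, fun i hi => ?_⟩
  · induction i with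
    | zero => simp
    | succ i ih =>
      intro hi
      obtain ⟨v, hv, hev⟩ := he i hi
      have ih := ih (by omega)
      simp only [Finset.sum_range_succ, hev]
      rw [← ih] at hv
      exact eq_of_changeAt (changeAt_changed hv.1) hv
  · obtain ⟨v, hv, hev⟩ := he i hi
    exact ⟨v, hv.1, by simp only [Finset.sum_range_succ, hev]⟩

lemma sum_add_single (c : V → ℤ) (v : V) :
    ∑ w, (c + Pi.single v 1 : V → ℤ) w = ∑ w, c w + 1 := by
  simp [Finset.sum_add_distrib]

/-- Along a sequence of changes ending at `c N`, every `d ≤ c N` other than `c N` admits a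
further change at a vertex whose value is at least `-m`. -/
lemma exists_lt_of_ne {n : V → ℤ} {N : ℕ} {c : ℕ → V → ℤ} (hzero : c 0 = 0)
    (hc : ∀ i < N, ∃ v, changed G m n (c i) v = -m v ∧ c (i + 1) = c i + Pi.single v 1)
    {d : V → ℤ} (hd0 : 0 ≤ d) (hd : d ≤ c N) (hne : d ≠ c N) :
    ∃ v, d v < c N v ∧ -m v ≤ changed G m n d v := by
  classical
  have hex : ∃ t, ¬ c t ≤ d := ⟨N, fun h => hne (le_antisymm hd h)⟩
  have htN : Nat.find hex ≤ N := Nat.find_min' hex fun h => hne (le_antisymm hd h)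
  obtain ⟨s, hs⟩ : ∃ s, Nat.find hex = s + 1 :=
    Nat.exists_eq_succ_of_ne_zero fun h0 => Nat.find_spec hex (by rw [h0, hzero]; exact hd0)
  have hle : c s ≤ d := not_not.1 (Nat.find_min hex (by omega))
  have hnot := Nat.find_spec hex
  obtain ⟨v, hv, hcs⟩ := hc s (by omega)
  have hvd : c s v = d v := by
    refine le_antisymm (hle v) (not_lt.1 fun hlt => hnot ?_)
    rw [hs, hcs]
    exact add_single_le hle hlt
  refine ⟨v, ?_, hv ▸ changed_le_of_apply_eq n hle hvd⟩
  have := counts_mono (fun i hi => (hc i hi).imp fun _ h => h.2) (show s + 1 ≤ N by omega) v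
  simp only [hcs, Pi.add_apply, Pi.single_eq_same] at this
  omega

lemma energy_counts {n : V → ℤ} {N : ℕ} {c : ℕ → V → ℤ} (hzero : c 0 = 0)
    (hc : ∀ i < N, ∃ v, changed G m n (c i) v = -m v ∧ c (i + 1) = c i + Pi.single v 1)
    {i : ℕ} (hi : i ≤ N) : energy G m n (c i) = 0 := by
  induction i with
  | zero => simp [hzero]
  | succ i ih =>
    obtain ⟨v, hv, hcv⟩ := hc i hi
    rw [hcv, energy_add_single, ih (by omega), hv]
    ring

lemma sum_counts {N : ℕ} {c : ℕ → V → ℤ} (hzero : c 0 = 0)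
    (hc : ∀ i < N, ∃ v, c (i + 1) = c i + Pi.single v 1) {i : ℕ} (hi : i ≤ N) :
    ∑ v, c i v = i := by
  induction i with
  | zero => simp [hzero]
  | succ i ih =>
    obtain ⟨v, hcv⟩ := hc i hi
    rw [hcv, sum_add_single, ih (by omega)]
    push_cast
    rfl

lemma energy_nonpos {n : V → ℤ} {N : ℕ} {c : ℕ → V → ℤ} (hzero : c 0 = 0)
    (hc : ∀ i < N, ∃ v, changed G m n (c i) v = -m v ∧ c (i + 1) = c i + Pi.single v 1)
    {d : V → ℤ} (hd0 : 0 ≤ d) (hd : d ≤ c N) : energy G m n d ≤ 0 := by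
  obtain ⟨k, hk⟩ : ∃ k : ℕ, ∑ v, c N v - ∑ v, d v = k :=
    Int.eq_ofNat_of_zero_le (sub_nonneg.2 (Finset.sum_le_sum fun v _ => hd v))
  induction k generalizing d with
  | zero =>
    by_cases hne : d = c N
    · rw [hne, energy_counts hzero hc le_rfl]
    obtain ⟨v, hv, -⟩ := exists_lt_of_ne hzero hc hd0 hd hne
    have := Finset.sum_lt_sum (fun w _ => hd w) ⟨v, Finset.mem_univ v, hv⟩
    push_cast at hk
    omega
  | succ k ih =>
    by_cases hne : d = c N
    · rw [hne, energy_counts hzero hc le_rfl]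
    obtain ⟨v, hv, hvm⟩ := exists_lt_of_ne hzero hc hd0 hd hne
    have := ih (d := d + Pi.single v 1)
      (add_nonneg hd0 (Pi.single_nonneg.2 zero_le_one)) (add_single_le hd hv)
      (by rw [sum_add_single]; push_cast at hk; omega)
    rw [energy_add_single] at this
    omega

/-- If at most `C v` changes can be made at each `v` and the energy stays nonpositive, then
changes can be made until a final association is reached. -/
lemma exists_changes_to_final {n C : V → ℤ} (hn : ∀ v, n v ≡ m v [ZMOD 2])
    (hbound : ∀ d, d ≤ C → ∀ v, -m v ≤ changed G m n d v → d v < C v)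
    (henergy : ∀ d, 0 ≤ d → d ≤ C → energy G m n d ≤ 0)
    {d : V → ℤ} (hd0 : 0 ≤ d) (hd : d ≤ C) (hdE : energy G m n d = 0)
    (hlow : m ≤ changed G m n d) {k : ℕ} (hk : ∑ v, C v - ∑ v, d v = k) :
    ∃ M ≤ k, ∃ s : ℕ → V → ℤ, s 0 = changed G m n d ∧ (∀ i ≤ M, IsAssociation m (s i)) ∧
      IsFinal m (s M) ∧ ∀ i < M, ∃ v, ChangeAt G m (s i) (s (i + 1)) v := by
  induction k using Nat.strong_induction_on generalizing d with
  | _ k ih =>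
    have hnonneg : ∀ v, 0 ≤ d + Pi.single v 1 := fun v =>
      add_nonneg hd0 (Pi.single_nonneg.2 zero_le_one)
    have hupper : ∀ v, changed G m n d v ≤ -m v := fun v => by
      by_contra! hv
      have := henergy _ (hnonneg v) (add_single_le hd (hbound d hd v hv.le))
      rw [energy_add_single] at this
      omega
    have hassoc : IsAssociation m (changed G m n d) := fun v =>
      ⟨(changed_modEq n d v).trans (hn v), abs_le.2 ⟨by simpa using hlow v, hupper v⟩⟩
    by_cases hfull : ∃ v, changed G m n d v = -m v
    · obtain ⟨v, hv⟩ := hfull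
      have hlt := hbound d hd v hv.ge
      have hsum := Finset.sum_lt_sum (fun w _ => hd w) ⟨v, Finset.mem_univ v, hlt⟩
      have hlow' : m ≤ changed G m n (d + Pi.single v 1) := fun w => by
        obtain rfl | hw := eq_or_ne w v
        · exact (changeAt_changed hv).2.1.ge
        · have h₁ := hlow w
          have h₂ := intersectionForm_nonneg (G := G) (m := m) hw
          rw [changed_add_single]
          linarith
      obtain ⟨M, hM, s, hs0, hs, hfinal, hchange⟩ := ih (k - 1) (by omega) (hnonneg v)
        (add_single_le hd hlt) (by rw [energy_add_single, hdE, hv]; ring) hlow'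
        (by rw [sum_add_single]; omega)
      refine ⟨M + 1, by omega, fun i => i.casesOn (changed G m n d) s, rfl, ?_, hfinal, ?_⟩
      · rintro (_ | i) hi
        · exact hassoc
        · exact hs i (by omega)
      · rintro (_ | i) hi
        · exact ⟨v, show ChangeAt G m _ (s 0) v from hs0 ▸ changeAt_changed hv⟩
        · exact hchange i (by omega)
    · push Not at hfull
      exact ⟨0, k.zero_le, fun _ => changed G m n d, rfl, fun _ _ => hassoc,
        fun v => ⟨hlow v, lt_of_le_of_ne (hupper v) (hfull v)⟩,
        fun i hi => absurd hi i.not_lt_zero⟩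

end WeightedGraph

/-- if `n₀, …, n_N` is a good sequence for `(G, m)` and `n` is an initial
association with `n ≤ n₀` pointwise, then there is a good sequence of length `M ≤ N`
starting at `n`. -/
theorem stmt_14 {V : Type*} [Fintype V] (G : SimpleGraph V) (m : V → ℤ)
    (N : ℕ) (nseq : ℕ → V → ℤ) (h : IsGoodSequence G m N nseq)
    (n : V → ℤ) (hassoc : IsAssociation m n) (hinit : IsInitial m n)
    (hle : ∀ w, n w ≤ nseq 0 w) :
    ∃ M ≤ N, ∃ n' : ℕ → V → ℤ, n' 0 = n ∧ IsGoodSequence G m M n' := by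
  classical
  obtain ⟨-, -, hfinal, hchange⟩ := h
  obtain ⟨c, hzero, hseq, hc⟩ := WeightedGraph.exists_counts (G := G) (m := m) (N := N)
    (s := nseq) fun i hi => hchange (i + 1) (by omega) hi
  have hc' : ∀ i < N, ∃ v, WeightedGraph.changed G m (nseq 0) (c i) v = -m v ∧
      c (i + 1) = c i + Pi.single v 1 := fun i hi => by
    rw [hseq i hi.le]
    exact hc i hi
  have hstep : ∀ i < N, ∃ v, c (i + 1) = c i + Pi.single v 1 :=
    fun i hi => (hc i hi).imp fun _ h => h.2
  obtain ⟨M, hM, s, hs0, hs, hsfinal, hschange⟩ :=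
    WeightedGraph.exists_changes_to_final (G := G) (m := m) (n := n) (C := c N) (d := 0) (k := N)
      (fun v => (hassoc v).1)
      (fun d hd v hv => by
        refine lt_of_le_of_ne (hd v) fun heq => ?_
        have h₁ := WeightedGraph.changed_le_of_apply_eq (G := G) (m := m) n hd heq
        have h₂ := WeightedGraph.changed_mono_left (G := G) (m := m) hle (c N) v
        rw [hseq N le_rfl] at h₂
        linarith [(hfinal v).2])
      (fun d hd0 hd => (WeightedGraph.energy_mono_left hle hd0).trans
        (WeightedGraph.energy_nonpos hzero hc' hd0 hd))
      le_rfl (hzero ▸ WeightedGraph.counts_mono hstep N.zero_le) (by simp)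
      ((WeightedGraph.changed_zero n).symm ▸ fun v => (hinit v).1.le)
      (by simp [WeightedGraph.sum_counts hzero hstep le_rfl])
  rw [WeightedGraph.changed_zero] at hs0
  refine ⟨M, hM, s, hs0, hs, hs0 ▸ hinit, hsfinal, fun i hi hiM => ?_⟩
  obtain ⟨j, rfl⟩ := Nat.exists_eq_add_of_le' hi
  exact hschange j hiM
end

section
/- Let G be a finite weighted graph with m(w) < 0 for every vertex w. Suppose G admits at least one good sequence, and that all good sequences for G have the same first (initial) association. Then every good sequence n_0, …, n_N for G satisfies n_0(w) = m(w) + 2 and n_N(w) = −m(w) − 2 for every vertex w. -/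
/-- `Fireable G m k c`: the association `c` can be turned into a final one by `k` changes. -/
inductive Fireable {V : Type*} (G : SimpleGraph V) (m : V → ℤ) : ℕ → (V → ℤ) → Prop
  | nil {c : V → ℤ} : IsAssociation m c → IsFinal m c → Fireable G m 0 c
  | cons {k : ℕ} {c c' : V → ℤ} {v : V} : IsAssociation m c → ChangeAt G m c c' v →
      Fireable G m k c' → Fireable G m (k + 1) c

section

variable {V : Type*} {G : SimpleGraph V} {m : V → ℤ}

theorem Fireable.isAssociation {k : ℕ} {c : V → ℤ} (h : Fireable G m k c) :
    IsAssociation m c := by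
  cases h <;> assumption

theorem isAssociation_iff {n : V → ℤ} :
    IsAssociation m n ↔ ∀ v, n v % 2 = m v % 2 ∧ m v ≤ n v ∧ n v ≤ -m v := by
  simp only [IsAssociation, abs_le, neg_neg, Int.ModEq]

theorem ChangeAt.unique {c c₁ c₂ : V → ℤ} {v : V} (h₁ : ChangeAt G m c c₁ v)
    (h₂ : ChangeAt G m c c₂ v) : c₁ = c₂ := by
  funext w
  obtain ⟨-, a₁, b₁, d₁⟩ := h₁
  obtain ⟨-, a₂, b₂, d₂⟩ := h₂
  by_cases hw : w = v
  · rw [hw, a₁, a₂]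
  · by_cases ha : G.Adj v w
    · rw [b₁ w ha, b₂ w ha]
    · rw [d₁ w hw ha, d₂ w hw ha]

open Classical in
theorem exists_changeAt {c : V → ℤ} {v : V} (h : c v = -m v) : ∃ c', ChangeAt G m c c' v := by
  refine ⟨fun w => if w = v then m v else if G.Adj v w then c w + 2 else c w, h, by simp, ?_, ?_⟩
  · intro w hw
    simp [hw, hw.ne']
  · intro w hw ha
    simp [hw, ha]

theorem ChangeAt.neg_s15 {c c' : V → ℤ} {v : V} (h : ChangeAt G m c c' v) :
    ChangeAt G m (-c') (-c) v := by
  obtain ⟨h₁, h₂, h₃, h₄⟩ := h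
  refine ⟨by simp [h₂], by simp [h₁], fun w hw => ?_, fun w hw ha => ?_⟩
  · simp [h₃ w hw]
  · simp [h₄ w hw ha]

theorem ChangeAt.le_of_ne {c c' : V → ℤ} {v w : V} (h : ChangeAt G m c c' v) (hw : w ≠ v) :
    c w ≤ c' w := by
  by_cases ha : G.Adj v w
  · rw [h.2.2.1 w ha]; omega
  · rw [h.2.2.2 w hw ha]

theorem ChangeAt.mono {c c' e e' : V → ℤ} {v : V} (hc : ChangeAt G m c c' v)
    (he : ChangeAt G m e e' v) (hle : e ≤ c) : e' ≤ c' := by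
  intro w
  have hlw : e w ≤ c w := hle w
  change e' w ≤ c' w
  by_cases hw : w = v
  · rw [hw, hc.2.1, he.2.1]
  · by_cases ha : G.Adj v w
    · rw [hc.2.2.1 w ha, he.2.2.1 w ha]; omega
    · rwa [hc.2.2.2 w hw ha, he.2.2.2 w hw ha]

/-- A change preserves associations as soon as it does not exceed the upper bound. -/
theorem ChangeAt.isAssociation {c c' : V → ℤ} {v : V} (h : ChangeAt G m c c' v)
    (hc : IsAssociation m c) (hle : ∀ w, c' w ≤ -m w) : IsAssociation m c' := by
  rw [isAssociation_iff] at hc ⊢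
  intro w
  have hw' := hc w
  have hl := hle w
  by_cases hw : w = v
  · subst hw
    have := h.2.1
    omega
  · by_cases ha : G.Adj v w
    · have := h.2.2.1 w ha
      omega
    · have := h.2.2.2 w hw ha
      omega

/-- Changes at distinct non-adjacent vertices commute. -/
theorem ChangeAt.comm {c c₁ c₂ d : V → ℤ} {u v : V} (hne : u ≠ v) (hadj : ¬ G.Adj u v)
    (hu : ChangeAt G m c c₁ u) (hv : ChangeAt G m c c₂ v) (hd : ChangeAt G m c₁ d v) :
    ChangeAt G m c₂ d u := by
  have hadj' : ¬ G.Adj v u := fun h => hadj h.symm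
  refine ⟨?_, ?_, fun w hw => ?_, fun w hw ha => ?_⟩
  · rw [hv.2.2.2 u hne hadj', hu.1]
  · rw [hd.2.2.2 u hne hadj', hu.2.1]
  · have hwv : w ≠ v := by rintro rfl; exact hadj hw
    by_cases ha : G.Adj v w
    · rw [hd.2.2.1 w ha, hv.2.2.1 w ha, hu.2.2.1 w hw]
    · rw [hd.2.2.2 w hwv ha, hv.2.2.2 w hwv ha, hu.2.2.1 w hw]
  · by_cases hwv : w = v
    · rw [hwv, hd.2.1, hv.2.1]
    · by_cases hb : G.Adj v w
      · rw [hd.2.2.1 w hb, hv.2.2.1 w hb, hu.2.2.2 w hw ha]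
      · rw [hd.2.2.2 w hwv hb, hv.2.2.2 w hwv hb, hu.2.2.2 w hw ha]

/-- Any available change may be performed first. -/
theorem Fireable.exchange {k : ℕ} {c : V → ℤ} (h : Fireable G m k c) {v : V} {c' : V → ℤ}
    (hv : ChangeAt G m c c' v) : ∃ k', k = k' + 1 ∧ Fireable G m k' c' := by
  induction h generalizing c' with
  | nil hc hf => exact absurd hv.1 (hf v).2.ne
  | @cons k c c₁ u hc hu hk ih =>
    refine ⟨k, rfl, ?_⟩
    by_cases huv : u = v
    · subst huv
      rwa [hv.unique hu]
    · have hadj : ¬ G.Adj u v := by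
        intro ha
        have h₁ := hu.2.2.1 v ha
        have h₂ := (isAssociation_iff.1 hk.isAssociation v).2.2
        have h₃ := hv.1
        omega
      obtain ⟨d, hd⟩ := exists_changeAt (G := G) (m := m) (c := c₁) (v := v)
        (by rw [hu.2.2.2 v (Ne.symm huv) hadj, hv.1])
      obtain ⟨k', rfl, hk'⟩ := ih hd
      have hcomm := hu.comm huv hadj hv hd
      refine .cons (hv.isAssociation hc fun w => ?_) hcomm hk'
      by_cases hw : w = u
      · rw [hw, hcomm.1]
      · exact (hcomm.le_of_ne hw).trans (isAssociation_iff.1 hk'.isAssociation w).2.2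

theorem Fireable.of_le {k : ℕ} {c e : V → ℤ} (h : Fireable G m k c) (he : IsAssociation m e)
    (hle : e ≤ c) : ∃ l, Fireable G m l e := by
  induction k generalizing c e with
  | zero =>
    cases h with
    | nil hc hf =>
      exact ⟨0, .nil he fun w => ⟨(isAssociation_iff.1 he w).2.1, (hle w).trans_lt (hf w).2⟩⟩
  | succ k ih =>
    by_cases hfin : IsFinal m e
    · exact ⟨0, .nil he hfin⟩
    · obtain ⟨v, hv⟩ : ∃ v, e v = -m v := by
        by_contra! hne
        exact hfin fun w => ⟨(isAssociation_iff.1 he w).2.1,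
          lt_of_le_of_ne (isAssociation_iff.1 he w).2.2 (hne w)⟩
      have hcv : c v = -m v :=
        le_antisymm (isAssociation_iff.1 h.isAssociation v).2.2 (hv ▸ hle v)
      obtain ⟨c', hc'⟩ := exists_changeAt (G := G) hcv
      obtain ⟨e', he'⟩ := exists_changeAt (G := G) hv
      obtain ⟨k', hk, hf⟩ := h.exchange hc'
      obtain rfl : k = k' := by omega
      have hle' := hc'.mono he' hle
      obtain ⟨l, hl⟩ := ih hf (he'.isAssociation he fun w =>
        (hle' w).trans (isAssociation_iff.1 hf.isAssociation w).2.2) hle'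
      exact ⟨l + 1, .cons he he' hl⟩

theorem Fireable.of_sequence {N : ℕ} {n : ℕ → V → ℤ} (ha : ∀ i ≤ N, IsAssociation m (n i))
    (hf : IsFinal m (n N)) (hc : ∀ i < N, ∃ v, ChangeAt G m (n i) (n (i + 1)) v) :
    Fireable G m N (n 0) := by
  induction N generalizing n with
  | zero => exact .nil (ha 0 le_rfl) hf
  | succ N ih =>
    obtain ⟨v, hv⟩ := hc 0 (by omega)
    exact .cons (ha 0 (by omega)) hv (ih (n := fun i => n (i + 1))
      (fun i hi => ha (i + 1) (by omega)) hf fun i hi => hc (i + 1) (by omega))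

theorem Fireable.exists_sequence {N : ℕ} {c : V → ℤ} (h : Fireable G m N c) :
    ∃ n : ℕ → V → ℤ, n 0 = c ∧ (∀ i ≤ N, IsAssociation m (n i)) ∧ IsFinal m (n N) ∧
      ∀ i < N, ∃ v, ChangeAt G m (n i) (n (i + 1)) v := by
  induction h with
  | @nil c ha hf => exact ⟨fun _ => c, rfl, fun _ _ => ha, hf, by simp⟩
  | @cons k c c' v ha hv hk ih =>
    obtain ⟨n, rfl, hn, hf, hc⟩ := ih
    refine ⟨fun i => Nat.casesOn i c n, rfl, ?_, hf, ?_⟩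
    · rintro (_ | i) hi
      · exact ha
      · exact hn i (by omega)
    · rintro (_ | i) hi
      · exact ⟨v, hv⟩
      · exact hc i (by omega)

theorem isGoodSequence_iff {N : ℕ} {n : ℕ → V → ℤ} :
    IsGoodSequence G m N n ↔ (∀ i ≤ N, IsAssociation m (n i)) ∧ IsInitial m (n 0) ∧
      IsFinal m (n N) ∧ ∀ i < N, ∃ v, ChangeAt G m (n i) (n (i + 1)) v := by
  refine and_congr_right fun _ => and_congr_right fun _ => and_congr_right fun _ => ?_
  constructor
  · intro h i hi
    exact h (i + 1) (by omega) (by omega)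
  · rintro h (_ | i) h₁ h₂
    · omega
    · exact h i (by omega)

theorem IsGoodSequence.reverse {N : ℕ} {n : ℕ → V → ℤ} (h : IsGoodSequence G m N n) :
    IsGoodSequence G m N fun i => -n (N - i) := by
  rw [isGoodSequence_iff] at h ⊢
  obtain ⟨ha, hi, hf, hc⟩ := h
  refine ⟨fun i _ => ?_, fun v => ?_, fun v => ?_, fun i hiN => ?_⟩
  · have := isAssociation_iff.1 (ha (N - i) (by omega))
    refine isAssociation_iff.2 fun v => ?_
    have := this v
    simp only [Pi.neg_apply]
    omega
  · have := hf v
    simp only [Pi.neg_apply, Nat.sub_zero]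
    omega
  · have := hi v
    simp only [Pi.neg_apply, Nat.sub_self]
    omega
  · obtain ⟨v, hv⟩ := hc (N - (i + 1)) (by omega)
    rw [show N - (i + 1) + 1 = N - i by omega] at hv
    exact ⟨v, hv.neg_s15⟩

/-- If there is a good sequence, then there is one starting at `m + 2`. -/
theorem IsGoodSequence.exists_minimal {N : ℕ} {n : ℕ → V → ℤ} (hm : ∀ w, m w < 0)
    (h : IsGoodSequence G m N n) :
    ∃ N' n', IsGoodSequence G m N' n' ∧ n' 0 = fun w => m w + 2 := by
  obtain ⟨ha, hi, hf, hc⟩ := isGoodSequence_iff.1 h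
  obtain ⟨l, hl⟩ := (Fireable.of_sequence ha hf hc).of_le (e := fun w => m w + 2)
    (isAssociation_iff.2 fun w => by have := hm w; omega)
    (fun w => by
      have := hi w
      have := isAssociation_iff.1 (ha 0 (by omega)) w
      dsimp only
      omega)
  obtain ⟨n', h₀, ha', hf', hc'⟩ := hl.exists_sequence
  refine ⟨l, n', isGoodSequence_iff.2 ⟨ha', fun w => ?_, hf', hc'⟩, h₀⟩
  have := hm w
  have := congrFun h₀ w
  omega

end

/-- if `m(w) < 0` for all vertices, `(G, m)` admits a good sequence, and all
good sequences share the same initial association, then every good sequence `n₀, …, n_N`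
satisfies `n₀ = m + 2` and `n_N = -m - 2`. -/
theorem stmt_15 {V : Type*} [Fintype V] (G : SimpleGraph V) (m : V → ℤ)
    (hm : ∀ w, m w < 0)
    (hex : ∃ (N : ℕ) (n : ℕ → V → ℤ), IsGoodSequence G m N n)
    (huniq : ∀ (N₁ : ℕ) (n₁ : ℕ → V → ℤ) (N₂ : ℕ) (n₂ : ℕ → V → ℤ),
      IsGoodSequence G m N₁ n₁ → IsGoodSequence G m N₂ n₂ → n₁ 0 = n₂ 0)
    (N : ℕ) (n : ℕ → V → ℤ) (h : IsGoodSequence G m N n) :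
    ∀ w, n 0 w = m w + 2 ∧ n N w = -m w - 2 := by
  obtain ⟨N', n', h', h₀⟩ := h.exists_minimal hm
  intro w
  have h₁ := congrFun ((huniq _ _ _ _ h h').trans h₀) w
  have h₂ := congrFun ((huniq _ _ _ _ h.reverse h').trans h₀) w
  simp only [Pi.neg_apply, Nat.sub_zero] at h₂
  omega
end

section
/- Let u, w, s be real numbers with u ≤ −1, w ≤ −1, and s ≤ −3. If (s+2)·u·w + (s+1)·w ≥ 1 + u, then u/(2u+1) + w/(1 − s·w) ≥ 1, and consequently 1/(−2 − 1/u) + 1/(s − 1/w) ≤ −1. (Under the stated hypotheses, 2u+1 < 0, 1 − s·w < 0, −2 − 1/u < 0 and s − 1/w < 0, so all the expressions are defined.) -/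
/-- for real `u ≤ -1`, `w ≤ -1`, `s ≤ -3`, if
`(s+2)uw + (s+1)w ≥ 1 + u` then `u/(2u+1) + w/(1 - sw) ≥ 1`, and consequently
`1/(-2 - 1/u) + 1/(s - 1/w) ≤ -1`. -/
theorem stmt_18 (u w s : ℝ) (hu : u ≤ -1) (hw : w ≤ -1) (hs : s ≤ -3)
    (h : (s + 2) * u * w + (s + 1) * w ≥ 1 + u) :
    u / (2 * u + 1) + w / (1 - s * w) ≥ 1 ∧
      1 / (-2 - 1 / u) + 1 / (s - 1 / w) ≤ -1 := by
  have hu1 : 2 * u + 1 < 0 := by linarith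
  have hw1 : 1 - s * w < 0 := by nlinarith
  have hu0 : u ≠ 0 := by linarith
  have hw0 : w ≠ 0 := by linarith
  have first : u / (2 * u + 1) + w / (1 - s * w) ≥ 1 := by
    rw [ge_iff_le, div_add_div _ _ hu1.ne hw1.ne, le_div_iff₀ (mul_pos_of_neg_of_neg hu1 hw1)]
    linarith
  have left_eq : 1 / (-2 - 1 / u) = -(u / (2 * u + 1)) := by
    rw [show -2 - 1 / u = -((2 * u + 1) / u) by field_simp; ring, div_neg, one_div_div]
  have right_eq : 1 / (s - 1 / w) = -(w / (1 - s * w)) := by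
    rw [show s - 1 / w = -((1 - s * w) / w) by field_simp; ring, div_neg, one_div_div]
  refine ⟨first, ?_⟩
  rw [left_eq, right_eq]
  linarith
end
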